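/- (Theorem 1: self-consistent probabilistic error cancellation.) Let Λ_S, Λ_M, Λ_1, …, Λ_T be invertible Pauli-diagonal maps on n qubits (the true noise). Let G_1,…,G_T be unitaries whose conjugation maps send every Pauli matrix to ± a Pauli matrix (Clifford layers), U_1,…,U_T unitaries, and D an invertible Pauli-diagonal map commuting with each conjugation 𝒰_t. Define the gauge-equivalent model Λ_{S,η} = D∘Λ_S, Λ_{M,η} = Λ_M∘D^{−1}, Λ_{t,η} = (𝒢_t^{−1}∘D∘𝒢_t)∘Λ_t∘D^{−1}, and let q^S, q^M, q^t denote the coefficients of the Pauli-diagonal inverses of Λ_{S,η}, Λ_{M,η}, Λ_{t,η} respectively. Then for every observable O and state ρ₀, Σ_{a_0,…,a_{T+1}} q^S_{a_0} q^1_{a_1} ⋯ q^T_{a_T} q^M_{a_{T+1}} · tr( O · Λ_M( 𝒫_{a_{T+1}}( 𝒢_T(Λ_T( 𝒫_{a_T}( 𝒰_T( ⋯ 𝒢_1(Λ_1( 𝒫_{a_1}( 𝒰_1( 𝒫_{a_0}( Λ_S(ρ₀) ))))))))))) ) = tr( O · 𝒢_T(𝒰_T(⋯ 𝒢_1(𝒰_1(ρ₀))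 ⋯)) ); i.e., running PEC as if the gauge-equivalent model were the ground truth still yields the exact noiseless expectation value. -/

import Mathlib

open Matrix Finset

noncomputable section

/-- The four single-qubit Pauli matrices: `σ₀ = I`, `σ₁ = X`, `σ₂ = Y`, `σ₃ = Z`. -/
def pauli1 : Fin 4 → Matrix (Fin 2) (Fin 2) ℂ
  | 0 => 1
  | 1 => !![0, 1; 1, 0]
  | 2 => !![0, -Complex.I; Complex.I, 0]
  | 3 => !![1, 0; 0, -1]

/-- The `n`-qubit Pauli matrix `P_a = σ_{a 1} ⊗ ⋯ ⊗ σ_{a n}` (Kronecker product realized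
as a matrix indexed by `Fin n → Fin 2`). -/
def PauliMat (n : ℕ) (a : Fin n → Fin 4) :
    Matrix (Fin n → Fin 2) (Fin n → Fin 2) ℂ :=
  fun x y => ∏ i, pauli1 (a i) (x i) (y i)

/-- The symplectic pairing `⟨a,b⟩`: the parity of the number of sites where the two Pauli
strings are both nontrivial and differ (so that `P_a P_b = (-1)^⟨a,b⟩ P_b P_a`).
The value is the parity, an element of `{0,1}`. -/
def pairing {n : ℕ} (a b : Fin n → Fin 4) : ℕ :=
  (Finset.univ.filter fun i => a i ≠ 0 ∧ b i ≠ 0 ∧ a i ≠ b i).card % 2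

/-- The Pauli-diagonal map `Λ(ρ) = Σ_a c_a P_a ρ P_a`. -/
def pauliDiag (n : ℕ) (c : (Fin n → Fin 4) → ℂ) :
    Matrix (Fin n → Fin 2) (Fin n → Fin 2) ℂ → Matrix (Fin n → Fin 2) (Fin n → Fin 2) ℂ :=
  fun ρ => ∑ a, c a • (PauliMat n a * ρ * PauliMat n a)

/-- Conjugation channel `ρ ↦ U ρ U†` of a unitary `U`. -/
def conjAct {m : Type*} [Fintype m] (U : Matrix m m ℂ) (ρ : Matrix m m ℂ) : Matrix m m ℂ :=
  U * ρ * Uᴴ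

/-- Conjugation `𝒫_a : ρ ↦ P_a ρ P_a` by a Pauli matrix. -/
def pconj (n : ℕ) (a : Fin n → Fin 4) (ρ : Matrix (Fin n → Fin 2) (Fin n → Fin 2) ℂ) :
    Matrix (Fin n → Fin 2) (Fin n → Fin 2) ℂ :=
  PauliMat n a * ρ * PauliMat n a

/-- Run a `T`-layer circuit: apply `step 0`, then `step 1`, …, then `step (T-1)`. -/
def runCirc {M : Type*} (T : ℕ) (step : Fin T → M → M) (ρ : M) : M :=
  (List.ofFn step).foldl (fun σ f => f σ) ρ

theorem pauli1_mul_comm (a b : Fin 4) :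
    ∃ s : ℂ, s * s = 1 ∧ pauli1 a * pauli1 b = s • (pauli1 b * pauli1 a) := by
  by_cases h : a = b ∨ a = 0 ∨ b = 0
  · refine ⟨1, one_mul 1, ?_⟩
    rcases h with rfl | rfl | rfl <;> simp [pauli1]
  · refine ⟨-1, by norm_num, ?_⟩
    fin_cases a <;> fin_cases b <;> simp_all [pauli1]

theorem PauliMat_mul_apply (n : ℕ) (a b : Fin n → Fin 4) (x y : Fin n → Fin 2) :
    (PauliMat n a * PauliMat n b) x y = ∏ i, (pauli1 (a i) * pauli1 (b i)) (x i) (y i) := by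
  simp only [Matrix.mul_apply, PauliMat, ← Finset.prod_mul_distrib]
  rw [Finset.prod_univ_sum, Fintype.piFinset_univ]

theorem PauliMat_mul_comm (n : ℕ) (a b : Fin n → Fin 4) :
    ∃ s : ℂ, s * s = 1 ∧ PauliMat n a * PauliMat n b = s • (PauliMat n b * PauliMat n a) := by
  choose s hs hab using fun i => pauli1_mul_comm (a i) (b i)
  refine ⟨∏ i, s i, by rw [← Finset.prod_mul_distrib]; simp [hs], ?_⟩
  ext x y
  simp only [Matrix.smul_apply, PauliMat_mul_apply, hab, smul_eq_mul, Finset.prod_mul_distrib]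

theorem pconj_comm (n : ℕ) (a b : Fin n → Fin 4)
    (ρ : Matrix (Fin n → Fin 2) (Fin n → Fin 2) ℂ) :
    pconj n a (pconj n b ρ) = pconj n b (pconj n a ρ) := by
  obtain ⟨s, hs, hab⟩ := PauliMat_mul_comm n a b
  calc pconj n a (pconj n b ρ)
      = (PauliMat n a * PauliMat n b) * ρ * (PauliMat n b * PauliMat n a) := by
        simp only [pconj, Matrix.mul_assoc]
    _ = (s * s) • ((PauliMat n b * PauliMat n a) * ρ * (PauliMat n a * PauliMat n b)) := by
        rw [hab, hs, one_smul, Matrix.smul_mul, Matrix.smul_mul, Matrix.mul_smul]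
    _ = pconj n b (pconj n a ρ) := by
        rw [hs, one_smul]
        simp only [pconj, Matrix.mul_assoc]

/-- Conjugation by a Pauli matrix as a linear map. -/
def pconjLin (n : ℕ) (a : Fin n → Fin 4) :
    Module.End ℂ (Matrix (Fin n → Fin 2) (Fin n → Fin 2) ℂ) :=
  LinearMap.mulLeftRight ℂ (PauliMat n a, PauliMat n a)

theorem pconjLin_apply (n : ℕ) (a : Fin n → Fin 4)
    (ρ : Matrix (Fin n → Fin 2) (Fin n → Fin 2) ℂ) : pconjLin n a ρ = pconj n a ρ := rfl

/-- A Pauli-diagonal map as a linear map. -/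
def pauliDiagLin (n : ℕ) (c : (Fin n → Fin 4) → ℂ) :
    Module.End ℂ (Matrix (Fin n → Fin 2) (Fin n → Fin 2) ℂ) :=
  ∑ a, c a • pconjLin n a

theorem pauliDiagLin_apply (n : ℕ) (c : (Fin n → Fin 4) → ℂ)
    (ρ : Matrix (Fin n → Fin 2) (Fin n → Fin 2) ℂ) :
    pauliDiagLin n c ρ = pauliDiag n c ρ := by
  simp [pauliDiagLin, pauliDiag, pconjLin_apply, pconj]

theorem pauliDiag_comm (n : ℕ) (c d : (Fin n → Fin 4) → ℂ)
    (ρ : Matrix (Fin n → Fin 2) (Fin n → Fin 2) ℂ) :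
    pauliDiag n c (pauliDiag n d ρ) = pauliDiag n d (pauliDiag n c ρ) := by
  have hP (a b) : Commute (pconjLin n a) (pconjLin n b) := LinearMap.ext (pconj_comm n a b)
  have h : Commute (pauliDiagLin n c) (pauliDiagLin n d) :=
    Commute.sum_left _ _ _ fun a _ => Commute.sum_right _ _ _ fun b _ =>
      ((hP a b).smul_left (c a)).smul_right (d b)
  simpa only [Module.End.mul_apply, pauliDiagLin_apply] using LinearMap.congr_fun h.eq ρ

/-- Conjugation by a matrix as a linear map. -/
def conjActLin {m : Type*} [Fintype m] (U : Matrix m m ℂ) : Module.End ℂ (Matrix m m ℂ) :=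
  LinearMap.mulLeftRight ℂ (U, Uᴴ)

theorem conjActLin_apply {m : Type*} [Fintype m] (U ρ : Matrix m m ℂ) :
    conjActLin U ρ = conjAct U ρ := rfl

theorem runCirc_zero {M : Type*} (step : Fin 0 → M → M) (ρ : M) : runCirc 0 step ρ = ρ := by
  simp [runCirc]

theorem runCirc_succ {M : Type*} (T : ℕ) (step : Fin (T + 1) → M → M) (ρ : M) :
    runCirc (T + 1) step ρ = runCirc T (fun t => step t.succ) (step 0 ρ) := by
  simp [runCirc]

/-- If `f` intertwines two circuits layer by layer, then it intertwines the circuits. -/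
theorem runCirc_semiconj {M N : Type*} (f : M → N) :
    ∀ (T : ℕ) (step : Fin T → M → M) (step' : Fin T → N → N),
      (∀ t, Function.Semiconj f (step t) (step' t)) →
      ∀ ρ, runCirc T step' (f ρ) = f (runCirc T step ρ)
  | 0, _, _, _, ρ => by simp only [runCirc_zero]
  | T + 1, step, step', h, ρ => by
    rw [runCirc_succ, runCirc_succ, ← h 0 ρ]
    exact runCirc_semiconj f T _ _ (fun t => h t.succ) _

/-- A circuit of linear layers depends linearly on its input. -/
theorem exists_linear_runCirc {V : Type*} [AddCommGroup V] [Module ℂ V] :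
    ∀ (T : ℕ) (L : Fin T → Module.End ℂ V),
      ∃ R : Module.End ℂ V, ∀ ρ, R ρ = runCirc T (fun t => L t) ρ
  | 0, _ => ⟨1, fun ρ => (runCirc_zero _ ρ).symm⟩
  | T + 1, L => by
    obtain ⟨R, hR⟩ := exists_linear_runCirc T fun t => L t.succ
    exact ⟨R * L 0, fun ρ => by rw [Module.End.mul_apply, hR, runCirc_succ]⟩

/-- Averaging a circuit of linear layers over independent weighted choices in each layer amounts
to averaging each layer separately. -/
theorem sum_prod_smul_runCirc {V ι : Type*} [AddCommGroup V] [Module ℂ V] [Fintype ι] :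
    ∀ (T : ℕ) (q : Fin T → ι → ℂ) (L : Fin T → ι → Module.End ℂ V) (ρ : V),
      ∑ a : Fin T → ι, (∏ t, q t (a t)) • runCirc T (fun t => L t (a t)) ρ =
        runCirc T (fun t => ⇑(∑ i, q t i • L t i)) ρ
  | 0, q, L, ρ => by simp [runCirc_zero]
  | T + 1, q, L, ρ => by
    obtain ⟨R, hR⟩ := exists_linear_runCirc T fun t => ∑ i, q t.succ i • L t.succ i
    rw [runCirc_succ, ← hR, ← (Fin.consEquiv fun _ => ι).sum_comp, Fintype.sum_prod_type,
      LinearMap.sum_apply, map_sum]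
    refine Finset.sum_congr rfl fun i _ => ?_
    rw [LinearMap.smul_apply, map_smul, hR, ← sum_prod_smul_runCirc, Finset.smul_sum]
    refine Finset.sum_congr rfl fun a _ => ?_
    simp only [Fin.consEquiv_apply, Fin.prod_univ_succ, Fin.cons_zero, Fin.cons_succ,
      runCirc_succ, mul_smul]

/-- Theorem 1 (self-consistent probabilistic error cancellation): running PEC with the
quasi-probability coefficients `q^S, q^1, …, q^T, q^M` of the inverses of any
gauge-equivalent noise model `Λ_{S,η} = D∘Λ_S`, `Λ_{M,η} = Λ_M∘D⁻¹`,
`Λ_{t,η} = (𝒢_t⁻¹∘D∘𝒢_t)∘Λ_t∘D⁻¹` — where the `𝒢_t` are Clifford layers and `D` is an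
invertible Pauli-diagonal gauge map commuting with the single-qubit layers `𝒰_t` — still
yields the exact noiseless expectation value, even though the true noise is
`Λ_S, Λ_1, …, Λ_T, Λ_M`. -/
theorem self_consistent_PEC_unbiased (n T : ℕ)
    (cS cM : (Fin n → Fin 4) → ℂ) (ct : Fin T → (Fin n → Fin 4) → ℂ)
    (d dinv : (Fin n → Fin 4) → ℂ)
    (hd : ∀ ρ, pauliDiag n d (pauliDiag n dinv ρ) = ρ)
    (hd' : ∀ ρ, pauliDiag n dinv (pauliDiag n d ρ) = ρ)
    (G U : Fin T → Matrix (Fin n → Fin 2) (Fin n → Fin 2) ℂ)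
    (hG : ∀ t, G t ∈ Matrix.unitaryGroup (Fin n → Fin 2) ℂ)
    (hCliff : ∀ (t : Fin T) (a : Fin n → Fin 4), ∃ b : Fin n → Fin 4,
      conjAct (G t) (PauliMat n a) = PauliMat n b ∨
      conjAct (G t) (PauliMat n a) = -PauliMat n b)
    (hU : ∀ t, U t ∈ Matrix.unitaryGroup (Fin n → Fin 2) ℂ)
    (hcomm : ∀ t ρ, pauliDiag n d (conjAct (U t) ρ) = conjAct (U t) (pauliDiag n d ρ))
    (qS qM : (Fin n → Fin 4) → ℂ) (qt : Fin T → (Fin n → Fin 4) → ℂ)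
    (hqS : ∀ ρ, pauliDiag n qS (pauliDiag n d (pauliDiag n cS ρ)) = ρ ∧
      pauliDiag n d (pauliDiag n cS (pauliDiag n qS ρ)) = ρ)
    (hqM : ∀ ρ, pauliDiag n qM (pauliDiag n cM (pauliDiag n dinv ρ)) = ρ ∧
      pauliDiag n cM (pauliDiag n dinv (pauliDiag n qM ρ)) = ρ)
    (hqt : ∀ (t : Fin T) ρ,
      pauliDiag n (qt t) ((G t)ᴴ * pauliDiag n d (conjAct (G t)
          (pauliDiag n (ct t) (pauliDiag n dinv ρ))) * G t) = ρ ∧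
      ((G t)ᴴ * pauliDiag n d (conjAct (G t)
          (pauliDiag n (ct t) (pauliDiag n dinv (pauliDiag n (qt t) ρ)))) * G t) = ρ)
    (O ρ₀ : Matrix (Fin n → Fin 2) (Fin n → Fin 2) ℂ) :
    (∑ a₀ : Fin n → Fin 4, ∑ aM : Fin n → Fin 4, ∑ av : Fin T → Fin n → Fin 4,
      (qS a₀ * (∏ t, qt t (av t)) * qM aM) *
        Matrix.trace (O * pauliDiag n cM (pconj n aM
          (runCirc T (fun t ρ =>
              conjAct (G t) (pauliDiag n (ct t) (pconj n (av t) (conjAct (U t) ρ))))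
            (pconj n a₀ (pauliDiag n cS ρ₀)))))) =
    Matrix.trace (O * runCirc T (fun t ρ => conjAct (G t) (conjAct (U t) ρ)) ρ₀) := by
  have hdinvU (t : Fin T) (ρ) :
      pauliDiag n dinv (conjAct (U t) ρ) = conjAct (U t) (pauliDiag n dinv ρ) := by
    rw [← hd' (conjAct (U t) (pauliDiag n dinv ρ)), hcomm, hd]
  have hlayer (t : Fin T) (ρ) :
      conjAct (G t) (pauliDiag n (ct t) (pauliDiag n (qt t) (pauliDiag n dinv ρ))) =
        pauliDiag n dinv (conjAct (G t) ρ) := by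
    have hGG : G t * (G t)ᴴ = 1 := Matrix.mem_unitaryGroup_iff.1 (hG t)
    have h := congrArg (conjAct (G t)) (hqt t ρ).2
    rw [pauliDiag_comm n dinv] at h
    generalize conjAct (G t) (pauliDiag n (ct t) _) = X at h ⊢
    have hX : conjAct (G t) ((G t)ᴴ * pauliDiag n d X * G t) = pauliDiag n d X := by
      calc conjAct (G t) ((G t)ᴴ * pauliDiag n d X * G t)
          = (G t * (G t)ᴴ) * pauliDiag n d X * (G t * (G t)ᴴ) := by
            simp only [conjAct, Matrix.mul_assoc]
        _ = pauliDiag n d X := by rw [hGG, Matrix.one_mul, Matrix.mul_one]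
    rw [← h, hX, hd']
  have hprep : pauliDiag n qS (pauliDiag n cS ρ₀) = pauliDiag n dinv ρ₀ := by
    rw [← hd' (pauliDiag n qS _), pauliDiag_comm n d, (hqS ρ₀).1]
  have hmeas (ρ) : pauliDiag n cM (pauliDiag n qM (pauliDiag n dinv ρ)) = ρ := by
    rw [pauliDiag_comm n qM, (hqM ρ).2]
  let L (t : Fin T) (a : Fin n → Fin 4) :
      Module.End ℂ (Matrix (Fin n → Fin 2) (Fin n → Fin 2) ℂ) :=
    conjActLin (G t) * pauliDiagLin n (ct t) * pconjLin n a * conjActLin (U t)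
  have hL (t : Fin T) : ∑ a, qt t a • L t a =
      conjActLin (G t) * pauliDiagLin n (ct t) * pauliDiagLin n (qt t) * conjActLin (U t) := by
    simp only [L, pauliDiagLin, Finset.mul_sum, Finset.sum_mul, mul_smul_comm, smul_mul_assoc]
  obtain ⟨R, hR⟩ := exists_linear_runCirc T fun t => ∑ a, qt t a • L t a
  let F : Matrix (Fin n → Fin 2) (Fin n → Fin 2) ℂ →ₗ[ℂ] ℂ :=
    Matrix.traceLinearMap _ ℂ ℂ ∘ₗ LinearMap.mulLeft ℂ O ∘ₗ pauliDiagLin n cM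
  have hF (ρ) : F ρ = Matrix.trace (O * pauliDiag n cM ρ) := by
    rw [← pauliDiagLin_apply]; rfl
  have hrun (a : Fin T → Fin n → Fin 4) (ρ) : runCirc T (fun t ρ =>
      conjAct (G t) (pauliDiag n (ct t) (pconj n (a t) (conjAct (U t) ρ)))) ρ =
      runCirc T (fun t => ⇑(L t (a t))) ρ := by
    congr 1; funext t ρ
    simp only [L, Module.End.mul_apply, pauliDiagLin_apply, conjActLin_apply, pconjLin_apply]
  calc _ = F (pauliDiagLin n qM (R (pauliDiagLin n qS (pauliDiag n cS ρ₀)))) := by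
        simp only [hrun, ← hF]
        simp only [← pconjLin_apply]
        rw [pauliDiagLin.eq_def n qS]
        simp only [LinearMap.sum_apply, LinearMap.smul_apply, map_sum, map_smul]
        refine Finset.sum_congr rfl fun a₀ _ => ?_
        rw [pauliDiagLin.eq_def n qM]
        simp only [LinearMap.sum_apply, LinearMap.smul_apply, map_sum, map_smul, Finset.smul_sum]
        refine Finset.sum_congr rfl fun aM _ => ?_
        rw [hR, ← sum_prod_smul_runCirc]
        simp only [map_sum, map_smul, smul_eq_mul, Finset.mul_sum]
        exact Finset.sum_congr rfl fun av _ => by ring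
    _ = _ := by
        rw [pauliDiagLin_apply n qS, hprep, hR, runCirc_semiconj (pauliDiag n dinv) T
          (fun t ρ => conjAct (G t) (conjAct (U t) ρ)), pauliDiagLin_apply, hF, hmeas]
        intro t ρ
        simp only [hL, Module.End.mul_apply, pauliDiagLin_apply, conjActLin_apply]
        rw [← hdinvU, hlayer]

end
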